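/- Let I ⊂ ℝ be an open interval, a ∈ C^N(I, ℂ) with N ≥ 1, λ ∈ ℂ \ {0}, and fix x ∈ I. Define F(t) = Σ_{j=0}^{N−1} (1/j!) (D^{λ,(j)}a)(t) (e^{λ(x−t)} − 1)^j for t ∈ I. Then for every t ∈ I, (1/λ) F′(t) = (1/(N−1)!) (D^{λ,(N)}a)(t) (e^{λ(x−t)} − 1)^{N−1}. -/

import Mathlib

open Complex Filter Finset Nat

/-- The differential operators `D^{λ,(j)}` acting on functions `ℝ → ℂ`:
`D^{λ,(0)} = Id` and `D^{λ,(j+1)} = ((1/λ)·d/dx − j·Id) ∘ D^{λ,(j)}`. -/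
noncomputable def expD (lam : ℂ) : ℕ → (ℝ → ℂ) → (ℝ → ℂ)
  | 0, a => a
  | (j + 1), a => fun x =>
      (1 / lam) * deriv (expD lam j a) x - (j : ℂ) * expD lam j a x

theorem contDiffOn_expD {s : Set ℝ} (hs : IsOpen s) (lam : ℂ) {a : ℝ → ℂ} (j n : ℕ)
    (ha : ContDiffOn ℝ (n + j : ℕ) a s) : ContDiffOn ℝ n (expD lam j a) s := by
  induction j generalizing n with
  | zero => simpa [expD] using ha
  | succ j ih =>
    have h : ContDiffOn ℝ (n + 1 : ℕ) (expD lam j a) s :=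
      ih (n + 1) (by rwa [show n + 1 + j = n + (j + 1) by omega])
    have h' : ContDiffOn ℝ n (deriv (expD lam j a)) s :=
      h.deriv_of_isOpen hs (by norm_cast)
    exact (contDiffOn_const.mul h').sub
      (contDiffOn_const.mul (h.of_le (by norm_cast; omega)))

theorem hasDerivAt_expD {lam : ℂ} (hlam : lam ≠ 0) {a : ℝ → ℂ} {j : ℕ} {t : ℝ}
    (h : DifferentiableAt ℝ (expD lam j a) t) :
    HasDerivAt (expD lam j a) (lam * (expD lam (j + 1) a t + j * expD lam j a t)) t := by
  refine h.hasDerivAt.congr_deriv ?_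
  simp only [expD]
  field_simp
  ring

theorem hasDerivAt_exp_sub_one (lam : ℂ) (x t : ℝ) :
    HasDerivAt (fun t : ℝ => Complex.exp (lam * (x - t)) - 1)
      (-lam * Complex.exp (lam * (x - t))) t := by
  have h := ((((hasDerivAt_id t).ofReal_comp).const_sub (x : ℂ)).const_mul lam).cexp.sub_const 1
  refine h.congr_deriv ?_
  simp only [id]
  push_cast
  ring

theorem hasDerivAt_sum_expD {lam : ℂ} (hlam : lam ≠ 0) {a : ℝ → ℂ} (x t : ℝ) (n : ℕ)
    (h : ∀ j ≤ n, DifferentiableAt ℝ (expD lam j a) t) :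
    HasDerivAt (fun t : ℝ => ∑ j ∈ Finset.range (n + 1),
        (1 / (j ! : ℂ)) * expD lam j a t * (Complex.exp (lam * (x - t)) - 1) ^ j)
      (lam * ((1 / (n ! : ℂ)) * expD lam (n + 1) a t *
        (Complex.exp (lam * (x - t)) - 1) ^ n)) t := by
  induction n with
  | zero => simpa using hasDerivAt_expD hlam (h 0 le_rfl)
  | succ n ih =>
    simp only [Finset.sum_range_succ _ (n + 1)]
    refine ((ih fun j hj => h j (by omega)).add
      (((hasDerivAt_expD hlam (h (n + 1) le_rfl)).const_mul (1 / ((n + 1)! : ℂ))).mul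
        ((hasDerivAt_exp_sub_one lam x t).pow (n + 1)))).congr_deriv ?_
    have hn : (n ! : ℂ) ≠ 0 := by exact_mod_cast n.factorial_ne_zero
    have hn' : (n : ℂ) + 1 ≠ 0 := by exact_mod_cast n.succ_ne_zero
    simp only [Nat.factorial_succ, Nat.add_sub_cancel, Pi.pow_apply]
    push_cast
    field_simp
    ring

theorem deriv_exp_taylor_partial_sum
    (I : Set ℝ) (hI : IsOpen I) (hI' : I.OrdConnected)
    (N : ℕ) (hN1 : 1 ≤ N) (a : ℝ → ℂ) (ha : ContDiffOn ℝ N a I)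
    (lam : ℂ) (hlam : lam ≠ 0)
    (x : ℝ) (hx : x ∈ I)
    (F : ℝ → ℂ)
    (hF : ∀ t, F t = ∑ j ∈ Finset.range N,
        (1 / (j ! : ℂ)) * expD lam j a t * (Complex.exp (lam * (x - t)) - 1) ^ j) :
    ∀ t ∈ I, (1 / lam) * deriv F t
      = (1 / ((N - 1)! : ℂ)) * expD lam N a t * (Complex.exp (lam * (x - t)) - 1) ^ (N - 1) := by
  intro t ht
  obtain ⟨n, rfl⟩ := Nat.exists_eq_add_of_le' hN1
  have hd : ∀ j ≤ n, DifferentiableAt ℝ (expD lam j a) t := fun j hj =>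
    ((contDiffOn_expD hI lam j 1 (ha.of_le (by norm_cast; omega))).differentiableOn
      (by norm_num)).differentiableAt (hI.mem_nhds ht)
  rw [funext hF, (hasDerivAt_sum_expD hlam x t n hd).deriv, Nat.add_sub_cancel,
    one_div lam, inv_mul_cancel_left₀ hlam]
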